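/- Let X be a compact Hausdorff space and φ : C(X) → ℝ a Riesz homomorphism with φ(1) = 1, where 1 is the constant function one. Then there exists a point x ∈ X such that φ(f) = f(x) for all f ∈ C(X). -/

import Mathlib

section RieszHom

variable {X : Type*} [TopologicalSpace X] {φ : C(X, ℝ) →ₗ[ℝ] ℝ}

theorem map_le_map_of_map_sup (hφ : ∀ f g : C(X, ℝ), φ (f ⊔ g) = φ f ⊔ φ g)
    {f g : C(X, ℝ)} (h : f ≤ g) : φ f ≤ φ g := by
  have := hφ f g
  rw [sup_eq_right.2 h] at this
  exact this ▸ le_sup_left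

theorem map_abs_of_map_sup (hφ : ∀ f g : C(X, ℝ), φ (f ⊔ g) = φ f ⊔ φ g) (f : C(X, ℝ)) :
    φ |f| = |φ f| := by
  rw [abs, abs, hφ, map_neg]

theorem exists_apply_eq_zero_of_map_eq_zero [CompactSpace X]
    (hφ : ∀ f g : C(X, ℝ), φ (f ⊔ g) = φ f ⊔ φ g) (hφ1 : φ 1 = 1)
    {f : C(X, ℝ)} (hf : 0 ≤ f) (h0 : φ f = 0) : ∃ x, f x = 0 := by
  have hne : Nonempty X := by
    by_contra hX
    rw [not_nonempty_iff] at hX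
    have h10 : (1 : C(X, ℝ)) = 0 := ContinuousMap.ext fun x => isEmptyElim x
    rw [h10, map_zero] at hφ1
    exact zero_ne_one hφ1
  obtain ⟨x, -, hx⟩ := isCompact_univ.exists_isMinOn Set.univ_nonempty f.continuous.continuousOn
  have hle : f x • (1 : C(X, ℝ)) ≤ f := fun y => by
    simpa using hx (Set.mem_univ y)
  have h := map_le_map_of_map_sup hφ hle
  rw [map_smul, hφ1, h0, smul_eq_mul, mul_one] at h
  exact ⟨x, h.antisymm (hf x)⟩

end RieszHom

theorem riesz_hom_is_point_evaluation {X : Type*} [TopologicalSpace X]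
    [CompactSpace X] [T2Space X]
    (φ : C(X, ℝ) →ₗ[ℝ] ℝ)
    (hφ : ∀ f g : C(X, ℝ), φ (f ⊔ g) = φ f ⊔ φ g)
    (hφ1 : φ 1 = 1) :
    ∃ x : X, ∀ f : C(X, ℝ), φ f = f x := by
  have hne : (⋂ f : C(X, ℝ), {x | φ f = f x}).Nonempty := by
    refine CompactSpace.iInter_nonempty
      (fun f => isClosed_eq continuous_const f.continuous) fun s => ?_
    have hnonneg : ∀ f ∈ s, 0 ≤ |f - φ f • (1 : C(X, ℝ))| := fun f _ => abs_nonneg _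
    have h0 : φ (∑ f ∈ s, |f - φ f • (1 : C(X, ℝ))|) = 0 := by
      rw [map_sum]
      refine Finset.sum_eq_zero fun f _ => ?_
      rw [map_abs_of_map_sup hφ, map_sub, map_smul, hφ1, smul_eq_mul, mul_one, sub_self, abs_zero]
    obtain ⟨x, hx⟩ := exists_apply_eq_zero_of_map_eq_zero hφ hφ1 (Finset.sum_nonneg hnonneg) h0
    rw [ContinuousMap.sum_apply] at hx
    refine ⟨x, Set.mem_iInter₂.2 fun f hf => ?_⟩
    have hfx := (Finset.sum_eq_zero_iff_of_nonneg fun f hf => hnonneg f hf x).1 hx f hf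
    change |f - φ f • (1 : C(X, ℝ))| x = 0 at hfx
    simp only [ContinuousMap.abs_apply, abs_eq_zero, ContinuousMap.sub_apply,
      ContinuousMap.smul_apply, ContinuousMap.one_apply, smul_eq_mul, mul_one] at hfx
    exact (sub_eq_zero.1 hfx).symm
  obtain ⟨x, hx⟩ := hne
  exact ⟨x, Set.mem_iInter.1 hx⟩
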